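/- Let X_1,...,X_d (d ≥ 2) and Y be discrete random variables with values in finite sets, jointly distributed with strictly positive pmf P, and let μ : {2,...,d} → {1,...,d} be a mother function (μ(i) < i for all i, μ(2) = 1). Then the Generalized Naive Bayes function P_GNB(x_1,...,x_d,y) = ( ∏_{i=2}^d P(y, x_{μ(i)}, x_i) ) / ( ∏_{i=3}^d P(y, x_{μ(i)}) ) is itself a probability mass function: it is nonnegative and its values sum to 1 over all (x_1,...,x_d,y). -/

import Mathlib

open scoped Classical BigOperators
open Real

noncomputable section

namespace GNB

variable {d : ℕ} {α : Fin d → Type} {β : Type} [∀ i, Fintype (α i)] [Fintype β]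

/-- A joint configuration of the explanatory variables `X i` and the class variable `Y`. -/
abbrev Cfg (α : Fin d → Type) (β : Type) := ((i : Fin d) → α i) × β

/-- Marginal pmf of the class variable `Y`. -/
def margY (P : Cfg α β → ℝ) (y : β) : ℝ := ∑ x : (i : Fin d) → α i, P (x, y)

/-- Marginal pmf of the variable `X i`. -/
def margX (P : Cfg α β → ℝ) (i : Fin d) (a : α i) : ℝ :=
  ∑ z : Cfg α β, if z.1 i = a then P z else 0

/-- Marginal pmf of the pair `(X i, Y)`. -/
def margXY (P : Cfg α β → ℝ) (i : Fin d) (a : α i) (y : β) : ℝ :=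
  ∑ x : (i : Fin d) → α i, if x i = a then P (x, y) else 0

/-- Marginal pmf of the triplet `(X i, X j, Y)`. -/
def margXXY (P : Cfg α β → ℝ) (i j : Fin d) (a : α i) (b : α j) (y : β) : ℝ :=
  ∑ x : (i : Fin d) → α i, if x i = a ∧ x j = b then P (x, y) else 0

/-- Joint entropy `H(X_1,…,X_d,Y)`. -/
def HJoint (P : Cfg α β → ℝ) : ℝ := -∑ z : Cfg α β, P z * Real.log (P z)

/-- Entropy `H(Y)`. -/
def HY (P : Cfg α β → ℝ) : ℝ := -∑ y : β, margY P y * Real.log (margY P y)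

/-- Entropy `H(X i)`. -/
def HX (P : Cfg α β → ℝ) (i : Fin d) : ℝ :=
  -∑ a : α i, margX P i a * Real.log (margX P i a)

/-- Entropy `H(Y, X i)`. -/
def HYX (P : Cfg α β → ℝ) (i : Fin d) : ℝ :=
  -∑ y : β, ∑ a : α i, margXY P i a y * Real.log (margXY P i a y)

/-- Entropy `H(Y, X i, X j)`. -/
def HYXX (P : Cfg α β → ℝ) (i j : Fin d) : ℝ :=
  -∑ y : β, ∑ a : α i, ∑ b : α j, margXXY P i j a b y * Real.log (margXXY P i j a b y)

/-- Mutual information `I(X i ; Y)`. -/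
def IY2 (P : Cfg α β → ℝ) (i : Fin d) : ℝ :=
  ∑ y : β, ∑ a : α i, margXY P i a y *
    Real.log (margXY P i a y / (margX P i a * margY P y))

/-- Information content `I(Y, X i, X j)`. -/
def IY3 (P : Cfg α β → ℝ) (i j : Fin d) : ℝ :=
  ∑ y : β, ∑ a : α i, ∑ b : α j, margXXY P i j a b y *
    Real.log (margXXY P i j a b y / (margY P y * margX P i a * margX P j b))

/-- Kullback–Leibler divergence `KL(p ‖ q)`. -/
def KL {γ : Type} [Fintype γ] (p q : γ → ℝ) : ℝ := ∑ c : γ, p c * Real.log (p c / q c)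

/-- The Naive Bayes approximation `P_NB(x,y) = P(y) ∏ i, P(x i | y)`. -/
def PNB (P : Cfg α β → ℝ) : Cfg α β → ℝ :=
  fun z => margY P z.2 * ∏ i : Fin d, (margXY P i (z.1 i) z.2 / margY P z.2)

/-- The Generalized Naive Bayes approximation determined by the mother function `μ`:
`P_GNB(x,y) = (∏_{i=2}^d P(y, x_{μ i}, x_i)) / (∏_{i=3}^d P(y, x_{μ i}))`
(indices are `0`-based: variable `X_k` of the paper is `X (k-1)` here). -/
def PGNB (P : Cfg α β → ℝ) (μ : Fin d → Fin d) : Cfg α β → ℝ :=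
  fun z =>
    (∏ i ∈ Finset.univ.filter (fun i : Fin d => 1 ≤ (i : ℕ)),
        margXXY P (μ i) i (z.1 (μ i)) (z.1 i) z.2) /
    (∏ i ∈ Finset.univ.filter (fun i : Fin d => 2 ≤ (i : ℕ)),
        margXY P (μ i) (z.1 (μ i)) z.2)

/-- Predecessor on `Fin d` (truncated at `0`). -/
def pred (i : Fin d) : Fin d := ⟨(i : ℕ) - 1, lt_of_le_of_lt (Nat.sub_le _ _) i.isLt⟩

end GNB

/-- If the factor `F i` depends only on the coordinates up to `i` and sums to `1` over the
`i`-th coordinate, then the product of all factors sums to `1`. -/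
theorem sum_prod_eq_one_of_sum_update_eq_one {n : ℕ} (α : Fin n → Type)
    [∀ i, Fintype (α i)] [∀ i, Nonempty (α i)] (F : Fin n → ((i : Fin n) → α i) → ℝ)
    (hF : ∀ i x x', (∀ j ≤ i, x j = x' j) → F i x = F i x')
    (hsum : ∀ i x, ∑ b : α i, F i (Function.update x i b) = 1) :
    ∑ x, ∏ i, F i x = 1 := by
  induction n with
  | zero => simp
  | succ n ih =>
    let b₀ : α (Fin.last n) := Classical.arbitrary _
    have hcast (i : Fin n) (b : α (Fin.last n)) (x : (i : Fin n) → α i.castSucc) :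
        F i.castSucc (Fin.snoc (α := α) x b) = F i.castSucc (Fin.snoc (α := α) x b₀) := by
      refine hF _ _ _ fun j hj => ?_
      obtain ⟨k, rfl⟩ := Fin.exists_castSucc_eq.2 (hj.trans_lt i.castSucc_lt_last).ne
      simp
    have hlast (x : (i : Fin n) → α i.castSucc) :
        ∑ b, F (Fin.last n) (Fin.snoc (α := α) x b) = 1 := by
      simpa only [Fin.update_snoc_last] using hsum (Fin.last n) (Fin.snoc (α := α) x b₀)
    rw [← (Fin.snocEquiv α).sum_comp, Fintype.sum_prod_type_right]
    change ∑ x : (i : Fin n) → α i.castSucc, ∑ b, ∏ i, F i (Fin.snoc (α := α) x b) = 1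
    simp only [Fin.prod_univ_castSucc, hcast, ← Finset.mul_sum, hlast, mul_one]
    refine ih _ (fun i x => F i.castSucc (Fin.snoc (α := α) x b₀)) ?_ ?_
    · intro i x x' h
      refine hF _ _ _ fun j hj => ?_
      obtain ⟨k, rfl⟩ := Fin.exists_castSucc_eq.2 (hj.trans_lt i.castSucc_lt_last).ne
      simpa using h k (by simpa using hj)
    · intro i x
      simpa only [Fin.snoc_update] using hsum i.castSucc (Fin.snoc (α := α) x b₀)

namespace GNB

section Marginals

variable {d : ℕ} {α : Fin d → Type} {β : Type} [∀ i, Fintype (α i)] {P : Cfg α β → ℝ}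

theorem margY_pos [∀ i, Nonempty (α i)] (hpos : ∀ z, 0 < P z) (y : β) : 0 < margY P y :=
  Finset.sum_pos (fun _ _ => hpos _) Finset.univ_nonempty

theorem margXY_pos [∀ i, Nonempty (α i)] (hpos : ∀ z, 0 < P z) (i : Fin d) (a : α i) (y : β) :
    0 < margXY P i a y := by
  refine Finset.sum_pos' (fun x _ => ?_)
    ⟨Function.update (Classical.arbitrary _) i a, Finset.mem_univ _, by simp [hpos]⟩
  split_ifs
  exacts [(hpos _).le, le_rfl]

theorem margXXY_nonneg (hpos : ∀ z, 0 < P z) (i j : Fin d) (a : α i) (b : α j) (y : β) :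
    0 ≤ margXXY P i j a b y := by
  refine Finset.sum_nonneg fun x _ => ?_
  split_ifs
  exacts [(hpos _).le, le_rfl]

theorem sum_margXY (P : Cfg α β → ℝ) (i : Fin d) (y : β) :
    ∑ a, margXY P i a y = margY P y := by
  unfold margXY margY
  rw [Finset.sum_comm]
  simp

theorem sum_margXXY (P : Cfg α β → ℝ) (i j : Fin d) (a : α i) (y : β) :
    ∑ b, margXXY P i j a b y = margXY P i a y := by
  unfold margXXY margXY
  rw [Finset.sum_comm]
  simp [ite_and]

/-- The conditional pmf of `X i` given `Y` and, unless `i` is the root, its mother `X (μ i)`. -/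
def condFactor (P : Cfg α β → ℝ) (μ : Fin d → Fin d) (y : β) (i : Fin d)
    (x : (i : Fin d) → α i) : ℝ :=
  if (i : ℕ) = 0 then margXY P i (x i) y / margY P y
  else margXXY P (μ i) i (x (μ i)) (x i) y / margXY P (μ i) (x (μ i)) y

theorem condFactor_congr {μ : Fin d → Fin d} (hμ : ∀ i : Fin d, 0 < (i : ℕ) → μ i < i)
    (y : β) (i : Fin d) (x x' : (i : Fin d) → α i) (h : ∀ j ≤ i, x j = x' j) :
    condFactor P μ y i x = condFactor P μ y i x' := by
  unfold condFactor
  split_ifs with hi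
  · rw [h i le_rfl]
  · rw [h i le_rfl, h (μ i) (hμ i (Nat.pos_of_ne_zero hi)).le]

theorem sum_condFactor_update [∀ i, Nonempty (α i)] (hpos : ∀ z, 0 < P z) {μ : Fin d → Fin d}
    (hμ : ∀ i : Fin d, 0 < (i : ℕ) → μ i < i) (y : β) (i : Fin d) (x : (i : Fin d) → α i) :
    ∑ b, condFactor P μ y i (Function.update x i b) = 1 := by
  unfold condFactor
  split_ifs with hi
  · simp only [Function.update_self]
    rw [← Finset.sum_div, sum_margXY, div_self (margY_pos hpos y).ne']
  · have hne : μ i ≠ i := (hμ i (Nat.pos_of_ne_zero hi)).ne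
    simp only [Function.update_self, Function.update_of_ne hne]
    rw [← Finset.sum_div, sum_margXXY, div_self (margXY_pos hpos _ _ y).ne']

theorem PGNB_nonneg [∀ i, Nonempty (α i)] (hpos : ∀ z, 0 < P z) (μ : Fin d → Fin d)
    (z : Cfg α β) : 0 ≤ PGNB P μ z :=
  div_nonneg (Finset.prod_nonneg fun _ _ => margXXY_nonneg hpos _ _ _ _ _)
    (Finset.prod_nonneg fun _ _ => (margXY_pos hpos _ _ _).le)

theorem PGNB_eq_margY_mul_prod [∀ i, Nonempty (α i)] (hd : 2 ≤ d) (hpos : ∀ z, 0 < P z)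
    {μ : Fin d → Fin d} (hμ : ∀ i : Fin d, 0 < (i : ℕ) → μ i < i) (z : Cfg α β) :
    PGNB P μ z = margY P z.2 * ∏ i, condFactor P μ z.2 i z.1 := by
  obtain ⟨n, rfl⟩ := Nat.exists_eq_add_of_le' hd
  have hμ₁ : μ 1 = 0 := Fin.ext (by simpa [Fin.lt_def] using hμ 1 (by simp))
  have hroot : margXY P (μ 1) (z.1 (μ 1)) z.2 = margXY P 0 (z.1 0) z.2 := by rw [hμ₁]
  have hY := (margY_pos hpos z.2).ne'
  have hX := (margXY_pos hpos 0 (z.1 0) z.2).ne'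
  simp only [PGNB, condFactor, Finset.prod_filter, Fin.prod_univ_succ (n := n + 1),
    Fin.prod_univ_succ (n := n)]
  simp [Finset.prod_div_distrib, hroot]
  field_simp

end Marginals

end GNB

/-- The Generalized Naive Bayes function associated with a mother
function `μ` is itself a probability mass function: it is nonnegative and its values
sum to `1` over all `(x₁,…,x_d,y)`. -/
theorem pgnb_is_pmf (d : ℕ) (hd : 2 ≤ d) (α : Fin d → Type) (β : Type)
    [∀ i, Fintype (α i)] [∀ i, Nonempty (α i)] [Fintype β] [Nonempty β]
    (P : GNB.Cfg α β → ℝ) (hpos : ∀ z, 0 < P z) (hsum : ∑ z, P z = 1)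
    (μ : Fin d → Fin d) (hμ : ∀ i : Fin d, 0 < (i : ℕ) → μ i < i) :
    (∀ z, 0 ≤ GNB.PGNB P μ z) ∧ (∑ z, GNB.PGNB P μ z = 1) := by
  refine ⟨GNB.PGNB_nonneg hpos μ, ?_⟩
  rw [Fintype.sum_prod_type_right] at hsum ⊢
  simp only [GNB.PGNB_eq_margY_mul_prod hd hpos hμ, ← Finset.mul_sum,
    sum_prod_eq_one_of_sum_update_eq_one α _ (GNB.condFactor_congr hμ _)
      (GNB.sum_condFactor_update hpos hμ _), mul_one]
  exact hsum
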